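/- For every n ≥ 3, with V the q-Varchenko matrix of the dihedral model D_n and P, S, T as below, writing t = 1 − q²: (T S P) V (T S P)^t is the diagonal matrix whose diagonal entries are, in order: 1, t, then t repeated n times, then t² repeated n times, and then, for each k = 2, …, p in turn, t² repeated n times followed by t³ repeated n times. Moreover det(T S P) = ±1. Consequently the q-Varchenko matrix of the dihedral model arrangement has Smith normal form diag(1, t·I_{n+1}, t²·I_{np}, t³·I_{n(p−1)}) over ℤ[q], realized by a congruence over ℤ[q] (after a further permutation congruence sorting the diagonal entries). -/

import Mathlib

open Matrix

noncomputable section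

/-- The indeterminate `q` of `ℤ[q]`. -/
def q : Polynomial ℤ := Polynomial.X

/-- The `n × n` cyclic shift permutation matrix `J = C(0,1,0,…,0)` over `ℤ[q]`:
the `(r,c)` entry is `1` iff `c ≡ r + 1 (mod n)`.  It satisfies `J^n = I` and
`Jᵀ = J^(n-1)`. -/
def Jmat (n : ℕ) : Matrix (Fin n) (Fin n) (Polynomial ℤ) :=
  Matrix.of fun r c => if (c : ℕ) = ((r : ℕ) + 1) % n then 1 else 0

/-- The `n × n` exchange matrix `K`: in `1`-based indexing the `(r,c)` entry is `1`
iff `r + c = n + 1`. -/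
def Kmat (n : ℕ) : Matrix (Fin n) (Fin n) (Polynomial ℤ) :=
  Matrix.of fun r c => if (r : ℕ) + (c : ℕ) + 1 = n then 1 else 0

/-- The `0`-indexed `m`-th entry of the first row of the circulant matrix `C_{ij}`:
the first row consists, in order, of the `i` entries `q^(j-i), q^(j-i+2), …, q^(j+i-2)`,
then `n+1-i-j` entries `q^(i+j)`, then the `i-1` entries `q^(j+i-2), …, q^(j-i+2)`,
then `j-i` entries `q^(j-i)`. -/
def firstRow (n i j m : ℕ) : Polynomial ℤ :=
  if m < i then q ^ (j - i + 2 * m)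
  else if m + j < n + 1 then q ^ (i + j)
  else if m + j < n + i then q ^ (i + j - 2 * (m + j - n))
  else q ^ (j - i)

/-- The circulant matrix `C_{ij}` (for `1 ≤ i ≤ j ≤ p`): its `(r,c)` entry is the
`((c - r) mod n)`-th (`0`-indexed) entry of its first row. -/
def Cmat (n i j : ℕ) : Matrix (Fin n) (Fin n) (Polynomial ℤ) :=
  Matrix.of fun r c => firstRow n i j ((c - r : Fin n) : ℕ)

/-- Index type for the `(2+2np) × (2+2np)` block matrices of the dihedral model:
one block index `0` of size `2` (`Sum.inl`) and block indices `1, …, p`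
(`Sum.inr (i, a, r)` with `i : Fin p` corresponding to the `1`-based block index
`i+1`), each of size `2n` (a `2 × 2` array of `n`-blocks, `a : Fin 2` selecting the
half). -/
abbrev DIdx (n p : ℕ) := Fin 2 ⊕ (Fin p × Fin 2 × Fin n)

/-- `B_{ij} = q · J^(i-1) · K · C_{ij}` (for `1`-based `i ≤ j`). -/
def Bmat (n i j : ℕ) : Matrix (Fin n) (Fin n) (Polynomial ℤ) :=
  q • ((Jmat n) ^ (i - 1) * Kmat n * Cmat n i j)

/-- The `q`-Varchenko matrix of the dihedral model `D_n` (Theorem 3.3):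
`(0,0)` block `[[1,q],[q,1]]`; `(0,j)` block `[[Q_j, Q_{j+1}],[Q_{j+1}, Q_j]]` and
`(j,0)` block its transpose; `(i,j)` block `[[C_{ij}, B_{ij}],[B_{ij}, C_{ij}]]` for
`i ≤ j`, and the transpose of the `(j,i)` block for `i > j` (`1`-based block
indices). -/
def Vdih (n p : ℕ) : Matrix (DIdx n p) (DIdx n p) (Polynomial ℤ) :=
  Matrix.of fun x y =>
    match x, y with
    | Sum.inl a, Sum.inl b => if a = b then 1 else q
    | Sum.inl a, Sum.inr (j, b, _) =>
        if a = b then q ^ ((j : ℕ) + 1) else q ^ ((j : ℕ) + 2)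
    | Sum.inr (i, a, _), Sum.inl b =>
        if a = b then q ^ ((i : ℕ) + 1) else q ^ ((i : ℕ) + 2)
    | Sum.inr (i, a, r), Sum.inr (j, b, c) =>
        if (i : ℕ) ≤ (j : ℕ) then
          (if a = b then Cmat n ((i : ℕ) + 1) ((j : ℕ) + 1) r c
           else Bmat n ((i : ℕ) + 1) ((j : ℕ) + 1) r c)
        else
          (if a = b then Cmat n ((j : ℕ) + 1) ((i : ℕ) + 1) c r
           else Bmat n ((j : ℕ) + 1) ((i : ℕ) + 1) c r)

/-- The block matrix `P` for the dihedral model: the identity, except that its `(0,0)`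
block is `[[1,0],[-q,1]]`, its `(1,0)` block is `[[-q·𝟙, 0],[0, -q·𝟙]]`, and its
`(k, k-1)` block is `-q·I_{2n}` for `2 ≤ k ≤ p`. -/
def Pdih (n p : ℕ) : Matrix (DIdx n p) (DIdx n p) (Polynomial ℤ) :=
  Matrix.of fun x y =>
    match x, y with
    | Sum.inl a, Sum.inl b =>
        if a = b then 1 else if a = 1 ∧ b = 0 then -q else 0
    | Sum.inl _, Sum.inr _ => 0
    | Sum.inr (i, a, _), Sum.inl b => if (i : ℕ) = 0 ∧ a = b then -q else 0
    | Sum.inr (i, a, r), Sum.inr (j, b, c) =>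
        if i = j then (if a = b ∧ r = c then 1 else 0)
        else if (i : ℕ) = (j : ℕ) + 1 then (if a = b ∧ r = c then -q else 0)
        else 0

/-- The block matrix `S` for the dihedral model: the identity, except that its
`(k, k-1)` block is `[[-qJ, 0],[0, -qJ]]` for `2 ≤ k ≤ p`. -/
def Sdih (n p : ℕ) : Matrix (DIdx n p) (DIdx n p) (Polynomial ℤ) :=
  Matrix.of fun x y =>
    match x, y with
    | Sum.inl a, Sum.inl b => if a = b then 1 else 0
    | Sum.inl _, Sum.inr _ => 0
    | Sum.inr _, Sum.inl _ => 0
    | Sum.inr (i, a, r), Sum.inr (j, b, c) =>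
        if i = j then (if a = b ∧ r = c then 1 else 0)
        else if (i : ℕ) = (j : ℕ) + 1 ∧ a = b then -q * Jmat n r c
        else 0

/-- The block matrix `T` for the dihedral model: block diagonal, its `(k,k)` block
being `[[I_n, 0],[-q·J^(k-1)·K, I_n]]` for `1 ≤ k ≤ p`. -/
def Tdih (n p : ℕ) : Matrix (DIdx n p) (DIdx n p) (Polynomial ℤ) :=
  Matrix.of fun x y =>
    match x, y with
    | Sum.inl a, Sum.inl b => if a = b then 1 else 0
    | Sum.inl _, Sum.inr _ => 0
    | Sum.inr _, Sum.inl _ => 0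
    | Sum.inr (i, a, r), Sum.inr (j, b, c) =>
        if i = j then
          (if a = b then (if r = c then 1 else 0)
           else if a = 1 ∧ b = 0 then -q * (((Jmat n) ^ (i : ℕ) * Kmat n) r c)
           else 0)
        else 0

/-- The diagonal matrix whose diagonal entries are, in order: `1`, `t`, then `t`
repeated `n` times, then `t²` repeated `n` times, and then, for each block
`k = 2, …, p` in turn, `t²` repeated `n` times followed by `t³` repeated `n` times
(`t = 1 - q²`). -/
def Ddih (n p : ℕ) : Matrix (DIdx n p) (DIdx n p) (Polynomial ℤ) :=
  Matrix.of fun x y =>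
    match x, y with
    | Sum.inl a, Sum.inl b =>
        if a = b then (if a = 0 then 1 else 1 - q ^ 2) else 0
    | Sum.inl _, Sum.inr _ => 0
    | Sum.inr _, Sum.inl _ => 0
    | Sum.inr (i, a, r), Sum.inr (j, b, c) =>
        if i = j ∧ a = b ∧ r = c then
          (if (i : ℕ) = 0 then
            (if a = 0 then 1 - q ^ 2 else (1 - q ^ 2) ^ 2)
           else
            (if a = 0 then (1 - q ^ 2) ^ 2 else (1 - q ^ 2) ^ 3))
        else 0

/-- The `k`-th diagonal entry (`0`-indexed) of the Smith normal form
`diag(1, t·I_{n+1}, t²·I_{np}, t³·I_{n(p-1)})`, `t = 1 - q²`. -/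
def snfDih (n p k : ℕ) : Polynomial ℤ :=
  if k = 0 then 1
  else if k < n + 2 then 1 - q ^ 2
  else if k < n + 2 + n * p then (1 - q ^ 2) ^ 2
  else (1 - q ^ 2) ^ 3

/-- Exponent of `firstRow`. -/
def fexp (n i j m : ℕ) : ℕ :=
  if m < i then j - i + 2 * m
  else if m + j < n + 1 then i + j
  else if m + j < n + i then i + j - 2 * (m + j - n)
  else j - i

theorem firstRow_eq (n i j m : ℕ) : firstRow n i j m = q ^ fexp n i j m := by
  unfold firstRow fexp
  split_ifs <;> rfl

/-- Cyclic difference `c - r`. -/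
def dm (n r c : ℕ) : ℕ := if r ≤ c then c - r else n + c - r

theorem fin_sub_val {n : ℕ} (r c : Fin n) : ((c - r : Fin n) : ℕ) = dm n r c := by
  rw [Fin.val_sub]
  have hr := r.2
  have hc := c.2
  unfold dm
  split_ifs with h
  · have : n - (r : ℕ) + c = n + (c - r) := by omega
    rw [this, Nat.add_mod_left, Nat.mod_eq_of_lt (by omega)]
  · rw [Nat.mod_eq_of_lt (by omega)]; omega

/-- Index type for the planar arrangement. -/
abbrev WIdx (n p : ℕ) := Unit ⊕ (Fin p × Fin n)

/-- Block number. -/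
def blk {n p : ℕ} : WIdx n p → ℕ
  | Sum.inl _ => 0
  | Sum.inr (i, _) => (i : ℕ) + 1

/-- Planar distance. -/
def wexp (n : ℕ) (i r j c : ℕ) : ℕ :=
  if i ≤ j then fexp n i j (dm n r c) else fexp n j i (dm n c r)

/-- Planar Varchenko matrix. -/
def Wmat (n p : ℕ) : Matrix (WIdx n p) (WIdx n p) (Polynomial ℤ) :=
  Matrix.of fun x y =>
    match x, y with
    | Sum.inl _, Sum.inl _ => 1
    | Sum.inl _, Sum.inr (j, _) => q ^ ((j : ℕ) + 1)
    | Sum.inr (i, _), Sum.inl _ => q ^ ((i : ℕ) + 1)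
    | Sum.inr (i, r), Sum.inr (j, c) => q ^ wexp n (i + 1) r (j + 1) c

/-- Planar `P`. -/
def P2 (n p : ℕ) : Matrix (WIdx n p) (WIdx n p) (Polynomial ℤ) :=
  Matrix.of fun x y =>
    match x, y with
    | Sum.inl _, Sum.inl _ => 1
    | Sum.inl _, Sum.inr _ => 0
    | Sum.inr (i, _), Sum.inl _ => if (i : ℕ) = 0 then -q else 0
    | Sum.inr (i, r), Sum.inr (j, c) =>
        if i = j then (if r = c then 1 else 0)
        else if (i : ℕ) = (j : ℕ) + 1 then (if r = c then -q else 0)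
        else 0

/-- Planar `S`. -/
def S2 (n p : ℕ) : Matrix (WIdx n p) (WIdx n p) (Polynomial ℤ) :=
  Matrix.of fun x y =>
    match x, y with
    | Sum.inl _, Sum.inl _ => 1
    | Sum.inl _, Sum.inr _ => 0
    | Sum.inr _, Sum.inl _ => 0
    | Sum.inr (i, r), Sum.inr (j, c) =>
        if i = j then (if r = c then 1 else 0)
        else if (i : ℕ) = (j : ℕ) + 1 then -q * Jmat n r c
        else 0

theorem wexp_symm (n p i r j c : ℕ) (hp : p = (n + 1) / 2) (hi : 1 ≤ i) (hip : i ≤ p)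
    (hj : 1 ≤ j) (hjp : j ≤ p) (hr : r < n) (hc : c < n) :
    wexp n i r j c = wexp n j c i r := by
  unfold wexp
  rcases lt_trichotomy i j with h | h | h
  · rw [if_pos h.le, if_neg (by omega)]
  · subst h
    simp only [le_refl, if_true]
    unfold fexp dm
    split_ifs <;> omega
  · rw [if_neg (by omega), if_pos h.le]

theorem Wmat_symm (n p : ℕ) (hp : p = (n + 1) / 2) : (Wmat n p)ᵀ = Wmat n p := by
  ext x y : 1
  rcases x with x | ⟨i, r⟩ <;> rcases y with y | ⟨j, c⟩ <;> simp only [Matrix.transpose_apply, Wmat, Matrix.of_apply]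
  rw [wexp_symm n p _ _ _ _ hp] <;> omega

theorem four_cancel (a b c e : ℕ)
    (h : (a = b + 1 ∧ c + 1 = e + 2) ∨ (a = c + 1 ∧ b + 1 = e + 2)) :
    q ^ a - q * q ^ b - q * (q ^ c - q * q ^ e) = 0 := by
  rcases h with ⟨h1, h2⟩ | ⟨h1, h2⟩
  · obtain rfl : c = e + 1 := by omega
    subst h1; ring
  · obtain rfl : b = e + 1 := by omega
    subst h1; ring

/-- extended exponent, with block 0. -/
def xexp (n : ℕ) (i r j c : ℕ) : ℕ :=
  if i = 0 then j else if j = 0 then i else wexp n i r j c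

theorem dm_facts (n r r' c : ℕ) (hr : r < n) (hc : c < n)
    (hr' : r' = if r + 1 < n then r + 1 else 0) :
    dm n c r < n ∧ (dm n c r' = if dm n c r + 1 < n then dm n c r + 1 else 0) ∧
    (dm n r c = if dm n c r = 0 then 0 else n - dm n c r) ∧
    dm n r' c = n - 1 - dm n c r ∧ (r ≠ c → dm n c r ≠ 0) := by
  unfold dm
  split_ifs at hr' <;> refine ⟨?_, ?_, ?_, ?_, ?_⟩ <;> split_ifs <;> omega

theorem fexp_zero (n j m : ℕ) : fexp n 0 j m = j := by
  unfold fexp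
  split_ifs <;> omega

set_option maxHeartbeats 4000000 in
theorem cancelA (n k j m m' : ℕ) (hk : 2 * k ≤ n + 1) (hj : 1 ≤ j) (hjk : j + 2 ≤ k)
    (hm : m < n) (hm' : m' = if m + 1 < n then m + 1 else 0) :
    (fexp n j k m = fexp n j (k - 1) m + 1 ∧
      fexp n j (k - 1) m' + 1 = fexp n j (k - 2) m' + 2) ∨
    (fexp n j k m = fexp n j (k - 1) m' + 1 ∧
      fexp n j (k - 1) m + 1 = fexp n j (k - 2) m' + 2) := by
  by_cases h1 : m + 1 < n
  · rw [if_pos h1] at hm'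
    subst hm'
    unfold fexp
    by_cases h2 : m + 1 < j
    · simp only [h2, (by omega : m < j), if_true]
      omega
    · simp only [h2, if_false]
      by_cases h3 : m < j
      · simp only [h3, if_true]
        split_ifs <;> omega
      · simp only [h3, if_false]
        split_ifs <;> omega
  · rw [if_neg h1] at hm'
    subst hm'
    unfold fexp
    have g1 : ¬ m < j := by omega
    have g2 : 0 < j := by omega
    simp only [g1, g2, if_true, if_false]
    split_ifs <;> omega

set_option maxHeartbeats 4000000 in
theorem cancelB (n j m m' : ℕ) (hk : 2 * (j + 1) ≤ n + 1) (hj : 1 ≤ j)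
    (hm : m < n) (hm' : m' = if m = 0 then 0 else n - m) :
    (fexp n j (j + 1) m = fexp n j j m' + 1 ∧
      fexp n j j (n - 1 - m) + 1 = fexp n (j - 1) j (n - 1 - m) + 2) ∨
    (fexp n j (j + 1) m = fexp n j j (n - 1 - m) + 1 ∧
      fexp n j j m' + 1 = fexp n (j - 1) j (n - 1 - m) + 2) := by
  by_cases h1 : m = 0
  · rw [if_pos h1] at hm'
    subst hm' h1
    unfold fexp
    split_ifs <;> omega
  · rw [if_neg h1] at hm'
    subst hm'
    unfold fexp
    by_cases h3 : m < j
    · simp only [h3, if_true]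
      have g1 : ¬ n - m < j := by omega
      have g2 : ¬ n - 1 - m < j := by omega
      have g3 : ¬ n - 1 - m < j - 1 := by omega
      simp only [g1, g2, g3, if_false]
      split_ifs <;> omega
    · simp only [h3, if_false]
      by_cases h4 : n - m < j
      · simp only [h4, (by omega : n - 1 - m < j), if_true]
        split_ifs <;> omega
      · simp only [h4, if_false]
        split_ifs <;> omega

set_option maxHeartbeats 4000000 in
theorem cancelC (n k m : ℕ) (hk : 2 * k ≤ n + 1) (hk2 : 2 ≤ k)
    (hm : m < n) (hm0 : m ≠ 0) :
    (fexp n k k m = fexp n (k - 1) k m + 1 ∧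
      fexp n (k - 1) k (m - 1) + 1 = fexp n (k - 2) k (m - 1) + 2) ∨
    (fexp n k k m = fexp n (k - 1) k (m - 1) + 1 ∧
      fexp n (k - 1) k m + 1 = fexp n (k - 2) k (m - 1) + 2) := by
  unfold fexp
  by_cases h3 : m < k
  · simp only [h3, (by omega : m - 1 < k - 1), if_true]
    split_ifs <;> omega
  · have g1 : ¬ m - 1 < k - 1 := by omega
    have g2 : ¬ m < k - 1 := by omega
    have g3 : ¬ m - 1 < k - 2 := by omega
    simp only [h3, g1, g2, g3, if_false]
    split_ifs <;> omega

theorem xcancel (n p k r r' j c : ℕ) (hn : 3 ≤ n) (hp : p = (n + 1) / 2) (hk : 2 ≤ k)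
    (hkp : k ≤ p) (hjk : j ≤ k) (hr : r < n) (hc : c < n)
    (hr' : r' = if r + 1 < n then r + 1 else 0) (h : j < k ∨ r ≠ c) :
    (xexp n k r j c = xexp n (k - 1) r j c + 1 ∧
      xexp n (k - 1) r' j c + 1 = xexp n (k - 2) r' j c + 2) ∨
    (xexp n k r j c = xexp n (k - 1) r' j c + 1 ∧
      xexp n (k - 1) r j c + 1 = xexp n (k - 2) r' j c + 2) := by
  obtain ⟨hm, h1, h2, h3, h4⟩ := dm_facts n r r' c hr hc hr'
  have hr2 : r' < n := by rw [hr']; split_ifs <;> omega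
  have hrc : j < k ∨ dm n c r ≠ 0 := h.imp id h4
  have hk0 : k ≠ 0 := by omega
  have hk1 : k - 1 ≠ 0 := by omega
  by_cases hj0 : j = 0
  · subst hj0
    simp only [xexp, hk0, hk1, if_true, if_false]
    split_ifs <;> omega
  have e0 : ∀ i s, i ≤ j → xexp n i s j c = fexp n i j (dm n s c) := by
    intro i s hij
    unfold xexp
    split_ifs with h5
    · subst h5; rw [fexp_zero]
    · rw [wexp, if_pos hij]
  have e1 : ∀ i s, s < n → i ≤ p → j ≤ i → xexp n i s j c = fexp n j i (dm n c s) := by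
    intro i s hs hip hij
    rw [xexp, if_neg (by omega), if_neg hj0,
      wexp_symm n p _ _ _ _ hp (by omega) hip (by omega) (by omega) hs hc, wexp, if_pos hij]
  obtain hj | hj | hj : j + 2 ≤ k ∨ j + 1 = k ∨ j = k := by omega
  · rw [e1 k r hr (by omega) (by omega), e1 (k - 1) r hr (by omega) (by omega),
      e1 (k - 1) r' hr2 (by omega) (by omega), e1 (k - 2) r' hr2 (by omega) (by omega)]
    exact cancelA n k j _ _ (by omega) (by omega) hj hm h1
  · subst hj
    have e6 : j + 1 - 2 = j - 1 := by omega
    rw [Nat.add_sub_cancel, e6]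
    rw [e1 (j + 1) r hr (by omega) (by omega), e0 j r le_rfl, e0 j r' le_rfl,
      e0 (j - 1) r' (by omega), h3]
    exact cancelB n j _ _ (by omega) (by omega) hm h2
  · subst hj
    rw [e0 j r le_rfl, e0 _ r (by omega), e0 _ r' (by omega), e0 _ r' (by omega)]
    have h5 : dm n c r ≠ 0 := by omega
    rw [if_neg h5] at h2
    have h6 : dm n r' c = dm n r c - 1 := by omega
    rw [h6]
    exact cancelC n j _ (by omega) hk (by omega) (by omega)

theorem xdiag (n p k r r' : ℕ) (hn : 3 ≤ n) (hp : p = (n + 1) / 2) (hk : 2 ≤ k)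
    (hkp : k ≤ p) (hr : r < n) 
    (hr' : r' = if r + 1 < n then r + 1 else 0) :
    xexp n k r k r = 0 ∧ xexp n (k - 1) r k r = 1 ∧ xexp n (k - 1) r' k r = 1 ∧ 
      xexp n (k - 2) r' k r = 2 := by
  have hk0 : k ≠ 0 := by omega
  have hk1 : k - 1 ≠ 0 := by omega
  have e2 : k - 1 ≤ k := by omega
  have e3 : k - 2 ≤ k := by omega
  simp only [xexp, hk1, hk0, if_false, wexp, le_refl, e2, e3, if_true]
  clear e2 e3 hk0 hk1 
  unfold fexp dm
  split_ifs at hr' <;> refine ⟨?_, ?_, ?_, ?_⟩ <;> split_ifs <;> omega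

/-- Cyclic successor. -/
def rsucc {n : ℕ} (r : Fin n) : Fin n :=
  ⟨if (r : ℕ) + 1 < n then r + 1 else 0, by have := r.2; split_ifs <;> omega⟩

theorem Jmat_apply {n : ℕ} (r c : Fin n) :
    Jmat n r c = if c = rsucc r then 1 else 0 := by
  simp only [Jmat, Matrix.of_apply, rsucc, Fin.ext_iff]
  have hr := r.2
  split_ifs with h1 h2 h3 h3 h2 h3 h3
  all_goals first
    | rfl
    | (exfalso
       first
         | (rw [Nat.mod_eq_of_lt (by omega)] at h1; omega)
         | (have : (r : ℕ) + 1 = n := by omega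
            rw [this, Nat.mod_self] at h1; omega))

/-- Predecessor without shift. -/
def prdP {n p : ℕ} (i : Fin p) (r : Fin n) : WIdx n p :=
  if (i : ℕ) = 0 then Sum.inl () else Sum.inr (⟨(i : ℕ) - 1, by omega⟩, r)

theorem P2_row {n p : ℕ} (i : Fin p) (r : Fin n) (y : WIdx n p) :
    P2 n p (Sum.inr (i, r)) y =
      (if y = Sum.inr (i, r) then 1 else 0) - (if y = prdP i r then q else 0) := by
  rcases y with y | ⟨j, c⟩
  · by_cases h : (i : ℕ) = 0 <;> simp [P2, prdP, h]
  · by_cases h : (i : ℕ) = 0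
    · have : ¬ (i : ℕ) = j + 1 := by omega
      simp only [P2, prdP, this, Matrix.of_apply, h, if_true]
      by_cases h1 : i = j <;> by_cases h2 : r = c <;> simp [h1, h2, eq_comm] <;> grind
    · simp only [P2, prdP, Matrix.of_apply, h, if_false]
      by_cases h1 : i = j
      · subst h1
        by_cases h2 : r = c <;> simp [h2, eq_comm, Fin.ext_iff] <;> grind
      · by_cases h2 : (i : ℕ) = j + 1 <;> by_cases h3 : r = c <;>
          simp [h1, h2, h3, eq_comm, Fin.ext_iff] <;> omega

theorem S2_row {n p : ℕ} (i : Fin p) (r : Fin n) (y : WIdx n p) :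
    S2 n p (Sum.inr (i, r)) y =
      (if y = Sum.inr (i, r) then 1 else 0) -
        (if (i : ℕ) = 0 then 0 else if y = prdP i (rsucc r) then q else 0) := by
  rcases y with y | ⟨j, c⟩
  · by_cases h : (i : ℕ) = 0 <;> simp [S2, prdP, h]
  · by_cases h : (i : ℕ) = 0
    · have : ¬ (i : ℕ) = j + 1 := by omega
      simp only [S2, this, Matrix.of_apply, h, if_true]
      by_cases h1 : i = j <;> by_cases h2 : r = c <;> simp [h1, h2, eq_comm] <;> grind
    · simp only [S2, prdP, Matrix.of_apply, h, if_false, Jmat_apply]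
      by_cases h1 : i = j
      · subst h1
        by_cases h2 : r = c <;> simp [h2, eq_comm, Fin.ext_iff] <;> grind
      · by_cases h2 : (i : ℕ) = j + 1 <;> by_cases h3 : c = rsucc r <;>
          simp [h1, h2, h3, eq_comm, Fin.ext_iff] <;> grind

theorem P2_mul_inr {n p : ℕ} (X : Matrix (WIdx n p) (WIdx n p) (Polynomial ℤ))
    (i : Fin p) (r : Fin n) (y : WIdx n p) :
    (P2 n p * X) (Sum.inr (i, r)) y = X (Sum.inr (i, r)) y - q * X (prdP i r) y := by
  simp only [Matrix.mul_apply, P2_row, sub_mul, Finset.sum_sub_distrib, ite_mul, one_mul,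
    zero_mul, Finset.sum_ite_eq', Finset.mem_univ, if_true]

theorem S2_mul_inr {n p : ℕ} (X : Matrix (WIdx n p) (WIdx n p) (Polynomial ℤ))
    (i : Fin p) (r : Fin n) (y : WIdx n p) :
    (S2 n p * X) (Sum.inr (i, r)) y = X (Sum.inr (i, r)) y -
      if (i : ℕ) = 0 then 0 else q * X (prdP i (rsucc r)) y := by
  by_cases h : (i : ℕ) = 0 <;>
  simp only [Matrix.mul_apply, S2_row, sub_mul, Finset.sum_sub_distrib, ite_mul, one_mul,
    zero_mul, Finset.sum_ite_eq', Finset.mem_univ, if_true, h, if_false, Finset.sum_const_zero]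

theorem P2_mul_inl {n p : ℕ} (X : Matrix (WIdx n p) (WIdx n p) (Polynomial ℤ))
    (u : Unit) (y : WIdx n p) :
    (P2 n p * X) (Sum.inl u) y = X (Sum.inl u) y := by
  simp [Matrix.mul_apply, P2]

theorem S2_mul_inl {n p : ℕ} (X : Matrix (WIdx n p) (WIdx n p) (Polynomial ℤ))
    (u : Unit) (y : WIdx n p) :
    (S2 n p * X) (Sum.inl u) y = X (Sum.inl u) y := by
  simp [Matrix.mul_apply, S2]

/-- Position inside a block. -/
def pos {n p : ℕ} : WIdx n p → ℕ
  | Sum.inl _ => 0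
  | Sum.inr (_, r) => r

theorem Wmat_apply {n p : ℕ} (x y : WIdx n p) :
    Wmat n p x y = q ^ xexp n (blk x) (pos x) (blk y) (pos y) := by
  rcases x with x | ⟨i, r⟩ <;> rcases y with y | ⟨j, c⟩ <;> simp [Wmat, xexp, blk, pos]

theorem xexp_zero (n r r' j c : ℕ) : xexp n 0 r j c = xexp n 0 r' j c := by
  simp [xexp]

theorem W_prdP {n p : ℕ} (i : Fin p) (r : Fin n) (y : WIdx n p) :
    Wmat n p (prdP i r) y = q ^ xexp n i r (blk y) (pos y) := by
  rw [Wmat_apply]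
  unfold prdP
  split_ifs with h
  · simp only [blk, h]; rw [xexp_zero]
  · simp only [blk, pos]; congr 2; omega

/-- Planar diagonal. -/
def D2 {n p : ℕ} (x : WIdx n p) : Polynomial ℤ :=
  if blk x = 0 then 1 else if blk x = 1 then 1 - q ^ 2 else (1 - q ^ 2) ^ 2

/-- Planar transformation. -/
def N2 (n p : ℕ) : Matrix (WIdx n p) (WIdx n p) (Polynomial ℤ) := S2 n p * P2 n p

theorem NW_apply {n p : ℕ} (hn : 3 ≤ n) (hp : p = (n + 1) / 2) (x y : WIdx n p)
    (h : blk y ≤ blk x) :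
    (N2 n p * Wmat n p) x y = if x = y then D2 x else 0 := by
  have hby : blk y ≤ p := by rcases y with y | ⟨j, c⟩ <;> simp [blk] <;> omega
  have hpy : pos y < n := by rcases y with y | ⟨j, c⟩ <;> simp [pos] <;> omega
  rw [N2, Matrix.mul_assoc]
  rcases x with x | ⟨i, r⟩
  · rw [S2_mul_inl, P2_mul_inl]
    rcases y with y | ⟨j, c⟩
    · simp [Wmat, D2, blk]
    · simp [blk] at h
  rw [S2_mul_inr, P2_mul_inr, W_prdP, Wmat_apply]
  split_ifs with h0 h1 h1
  · subst h1
    simp only [blk, pos, h0, D2]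
    norm_num [xexp, wexp, fexp, dm]
    ring
  · rw [sub_zero]
    have h' : blk y ≤ 1 := by simpa [blk, h0] using h
    have e7 : blk (Sum.inr (i, r) : WIdx n p) = 1 := by simp [blk, h0]
    rw [e7, h0]
    obtain hj | hj : blk y = 0 ∨ blk y = 1 := by omega
    · simp [xexp, hj]
    · rcases y with y | ⟨j, c⟩
      · simp [blk] at hj
      simp [blk] at hj
      have hj' : i = j := by ext; omega
      have hrc : (r : ℕ) ≠ c := by
        rintro h; apply h1; rw [hj', Fin.ext h]
      simp only [blk, pos, hj, xexp, wexp]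
      have : fexp n 1 1 (dm n r c) = 2 := by
        unfold fexp dm
        split_ifs <;> omega
      norm_num [this]
      ring
  all_goals
    have e1 : prdP (n := n) i (rsucc r) = Sum.inr (⟨(i : ℕ) - 1, by omega⟩, rsucc r) := by
      simp [prdP, h0]
    rw [e1, P2_mul_inr, W_prdP, Wmat_apply]
  · subst h1
    obtain ⟨h2, h3, h4, h5⟩ := xdiag n p (i + 1) r (rsucc r) hn hp (by omega) (by omega) r.2 rfl
    simp only [blk, pos] at *
    have h6 : (i : ℕ) + 1 - 2 = i - 1 := by omega
    have h7 : (i : ℕ) - 1 + 1 = i := by omega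
    simp only [Nat.add_sub_cancel, h6] at h2 h3 h4 h5
    simp only [h7, h2, h3, h4, h5, D2, blk]
    simp [h0]
    ring
  · have hx := xcancel n p (i + 1) r (rsucc r) (blk y) (pos y) hn hp (by omega) (by omega) h r.2 hpy rfl
      (by
        by_contra hcon
        push Not at hcon
        apply h1
        rcases y with y | ⟨j, c⟩
        · simp [blk] at hcon
        · simp only [blk, pos] at hcon
          have h9 : (j : ℕ) + 1 ≤ (i : ℕ) + 1 := h
          congr 2 <;> ext <;> omega)
    simp only [blk, pos] at hx ⊢
    have h6 : (i : ℕ) + 1 - 2 = i - 1 := by omega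
    have h7 : (i : ℕ) - 1 + 1 = i := by omega
    simp only [Nat.add_sub_cancel, h6] at hx
    rw [h7]
    exact four_cancel _ _ _ _ hx

theorem N2_apply {n p : ℕ} (x y : WIdx n p) (h : blk x ≤ blk y) :
    N2 n p x y = if x = y then 1 else 0 := by
  rw [N2]
  rcases x with x | ⟨i, r⟩
  · rw [S2_mul_inl]
    rcases y with y | ⟨j, c⟩
    · simp [P2]
    · simp [P2]
  · have h1 : ∀ (j : Fin p) (s : Fin n), (j : ℕ) ≤ i → y ≠ prdP j s := by
      rintro j s hj rfl
      unfold prdP at h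
      split_ifs at h with h0
      · simp [blk] at h
      · simp only [blk] at h; omega
    rw [S2_mul_inr, P2_row, if_neg (h1 i r le_rfl)]
    by_cases h0 : (i : ℕ) = 0
    · simp [h0, eq_comm]
    · have e1 : prdP (n := n) i (rsucc r) = Sum.inr (⟨(i : ℕ) - 1, by omega⟩, rsucc r) := by
        simp [prdP, h0]
      rw [if_neg h0, ]
      have h2 := h1 i (rsucc r) le_rfl
      rw [e1] at h2 ⊢
      rw [P2_row, if_neg h2, if_neg (h1 _ _ (by simp))]
      simp [eq_comm]

theorem NWN {n p : ℕ} (hn : 3 ≤ n) (hp : p = (n + 1) / 2) :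
    N2 n p * Wmat n p * (N2 n p)ᵀ = Matrix.diagonal D2 := by
  have key : ∀ x z : WIdx n p, blk z ≤ blk x →
      (N2 n p * Wmat n p * (N2 n p)ᵀ) x z = if x = z then D2 x else 0 := by
    intro x z hzx
    rw [Matrix.mul_apply]
    have : ∀ y, (N2 n p * Wmat n p) x y * (N2 n p)ᵀ y z =
        if y = x then (if x = z then D2 x else 0) else 0 := by
      intro y
      rw [Matrix.transpose_apply]
      rcases le_or_gt (blk y) (blk x) with h1 | h1
      · rw [NW_apply hn hp x y h1]
        by_cases h2 : x = y
        · subst h2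
          rw [N2_apply z x hzx]
          by_cases h3 : x = z <;> simp [h3, eq_comm]
        · simp [h2, Ne.symm h2]
      · have h2 : ¬ y = x := by rintro rfl; omega
        have h3 : ¬ z = y := by rintro rfl; omega
        rw [N2_apply z y (by omega)]
        simp [h2, h3]
    rw [Finset.sum_congr rfl (fun y _ => this y), Finset.sum_ite_eq' Finset.univ x, if_pos (Finset.mem_univ _)]
  have symm : (N2 n p * Wmat n p * (N2 n p)ᵀ)ᵀ = N2 n p * Wmat n p * (N2 n p)ᵀ := by
    simp [Matrix.transpose_mul, Wmat_symm n p hp, Matrix.mul_assoc]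
  ext x z : 1
  rw [Matrix.diagonal_apply]
  rcases le_total (blk z) (blk x) with h | h
  · exact key x z h
  · rw [← symm, Matrix.transpose_apply, key z x h]
    by_cases h3 : x = z
    · subst h3; rfl
    · simp [h3, Ne.symm h3]

theorem N2_det (n p : ℕ) : (N2 n p).det = 1 := by
  rw [← Matrix.det_transpose]
  have hb : Matrix.BlockTriangular (N2 n p)ᵀ blk := by
    intro x y h
    rw [Matrix.transpose_apply, N2_apply _ _ h.le, if_neg]
    rintro rfl
    exact lt_irrefl _ h
  rw [hb.det]
  apply Finset.prod_eq_one
  intro k _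
  have : (N2 n p)ᵀ.toSquareBlock blk k = 1 := by
    ext x y : 1
    have : blk y.1 = blk x.1 := by rw [x.2, y.2]
    rw [Matrix.toSquareBlock_def, Matrix.of_apply, Matrix.transpose_apply, N2_apply _ _ this.le,
      Matrix.one_apply]
    simp only [Subtype.ext_iff, eq_comm]
  rw [this, Matrix.det_one]

/-- Reflection on positions in a block. -/
def rho {n : ℕ} (i : ℕ) (r : Fin n) : Fin n :=
  ⟨n - 1 - ((r : ℕ) + i) % n, by have := r.2; omega⟩

theorem rho_val {n : ℕ} (i : ℕ) (hi : i < n) (r : Fin n) :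
    ((rho i r : Fin n) : ℕ) = if (r : ℕ) + i < n then n - 1 - r - i else 2 * n - 1 - r - i := by
  have hr := r.2
  unfold rho
  simp only
  split_ifs with h
  · rw [Nat.mod_eq_of_lt h]; omega
  · rw [Nat.mod_eq_sub_mod (by omega), Nat.mod_eq_of_lt (by omega)]; omega

theorem rho_rho {n : ℕ} (i : ℕ) (hi : i < n) (r : Fin n) : rho i (rho i r) = r := by
  have hr := r.2
  ext
  rw [rho_val i hi, rho_val i hi]
  split_ifs <;> omega

theorem rho_rsucc {n : ℕ} (i : ℕ) (hi : i + 1 < n) (r : Fin n) :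
    rho i (rsucc r) = rho (i + 1) r := by
  have hr := r.2
  ext
  rw [rho_val i (by omega), rho_val (i + 1) hi]
  unfold rsucc
  simp only
  split_ifs <;> omega

theorem rsucc_rho {n : ℕ} (i : ℕ) (hi : i + 1 < n) (r : Fin n) :
    rsucc (rho (i + 1) r) = rho i r := by
  have hr := r.2
  ext
  rw [rho_val i (by omega)]
  unfold rsucc
  simp only
  rw [rho_val (i + 1) hi]
  split_ifs <;> omega

theorem Jpow_apply {n : ℕ} (s : ℕ) (r c : Fin n) :
    (Jmat n ^ s) r c = if (c : ℕ) = ((r : ℕ) + s) % n then 1 else 0 := by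
  induction s generalizing r with
  | zero =>
    rw [pow_zero, Matrix.one_apply, Nat.add_zero, Nat.mod_eq_of_lt r.2]
    simp only [Fin.ext_iff, eq_comm]
  | succ s ih =>
    rw [pow_succ', Matrix.mul_apply]
    simp only [Jmat_apply, ite_mul, one_mul, zero_mul, Finset.sum_ite_eq', Finset.mem_univ,
      if_true, ih]
    have : ((rsucc r : Fin n) : ℕ) = ((r : ℕ) + 1) % n := by
      have hr := r.2
      unfold rsucc
      simp only
      split_ifs with h
      · rw [Nat.mod_eq_of_lt h]
      · have : (r : ℕ) + 1 = n := by omega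
        rw [this, Nat.mod_self]
    rw [this, Nat.mod_add_mod]
    congr 3; ring

theorem JK_apply {n : ℕ} (s : ℕ) (r c : Fin n) :
    (Jmat n ^ s * Kmat n) r c = if c = rho s r then 1 else 0 := by
  have hr := r.2
  have hlt : ((r : ℕ) + s) % n < n := Nat.mod_lt _ (by omega)
  have h1 : ∀ k : Fin n, ((k : ℕ) = ((r : ℕ) + s) % n) = (k = ⟨((r : ℕ) + s) % n, hlt⟩) := by
    intro k; simp only [Fin.ext_iff]
  rw [Matrix.mul_apply]
  have h2 : ∀ k : Fin n, (Jmat n ^ s) r k * Kmat n k c =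
      if k = ⟨((r : ℕ) + s) % n, hlt⟩ then Kmat n k c else 0 := by
    intro k
    rw [Jpow_apply, ite_mul, one_mul, zero_mul]
    exact if_congr (iff_of_eq (h1 k)) rfl rfl
  rw [Finset.sum_congr rfl (fun k _ => h2 k), Finset.sum_ite_eq', if_pos (Finset.mem_univ _)]
  simp only [Kmat, Matrix.of_apply, Fin.ext_iff, rho]
  have hc := c.2
  generalize ((r : ℕ) + s) % n = z at *
  split_ifs <;> first | rfl | (exfalso; omega)

theorem Cmat_apply {n : ℕ} (i j : ℕ) (r c : Fin n) :
    Cmat n i j r c = q ^ fexp n i j (dm n r c) := by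
  simp only [Cmat, Matrix.of_apply, fin_sub_val, firstRow_eq]

theorem Bmat_apply {n : ℕ} (i j : ℕ) (r c : Fin n) :
    Bmat n (i + 1) j r c = q * q ^ fexp n (i + 1) j (dm n (rho i r : Fin n) c) := by
  rw [Bmat, Matrix.smul_apply, Matrix.mul_apply]
  simp only [Nat.add_sub_cancel, JK_apply, ite_mul, one_mul, zero_mul, Finset.sum_ite_eq',
    Finset.mem_univ, if_true, Cmat_apply, smul_eq_mul]

theorem fexp_refl (n i j m m' : ℕ) (hi : 1 ≤ i) (hij : i ≤ j) (hj : 2 * j ≤ n + 1) (hm : m < n)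
    (hm' : m' = if m + (j - i) = 0 then 0 else if m + (j - i) ≤ n then n - (m + (j - i))
      else 2 * n - (m + (j - i))) (hn : 3 ≤ n) :
    fexp n i j m' = fexp n i j m := by
  unfold fexp
  split_ifs at hm' <;> split_ifs <;> omega

theorem dm_rho {n : ℕ} (i j : ℕ) (hij : i ≤ j) (hj : j < n) (r c : Fin n)
    (hn : 3 ≤ n) (hj2 : 2 * j + 2 ≤ n + 1) :
    fexp n (i + 1) (j + 1) (dm n (rho i r : Fin n) (rho j c : Fin n)) =
      fexp n (i + 1) (j + 1) (dm n r c) := by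
  have hr := r.2
  have hc := c.2
  have h1 : dm n r c < n := by unfold dm; split_ifs <;> omega
  have h2 : ∃ m', m' = dm n (rho i r : Fin n) (rho j c : Fin n) ∧
     ((m' = if dm n r c + (j - i) = 0 then 0 else if dm n r c + (j - i) ≤ n then
        n - (dm n r c + (j - i)) else 2 * n - (dm n r c + (j - i))) ∨
        (dm n r c + (j - i) = n ∧ m' = 0)) := by
    refine ⟨_, rfl, ?_⟩
    rw [rho_val i (by omega), rho_val j hj]
    unfold dm
    split_ifs <;> omega
  obtain ⟨m', h3, h4⟩ := h2
  rw [← h3]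
  apply fexp_refl n (i + 1) (j + 1) _ _ (by omega) (by omega) (by omega) h1 _ hn
  have : j + 1 - (i + 1) = j - i := by omega
  rw [this]
  rcases h4 with h4 | ⟨h4, h5⟩
  · exact h4
  · rw [h4, h5]; split_ifs <;> omega

/-- Re-indexing. -/
def phi {n p : ℕ} (hp : p ≤ n) : WIdx n p × Fin 2 ≃ DIdx n p where
  toFun x := match x with
    | (Sum.inl _, a) => Sum.inl a
    | (Sum.inr (i, r), a) => Sum.inr (i, a, if a = 0 then r else rho i r)
  invFun x := match x with
    | Sum.inl a => (Sum.inl (), a)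
    | Sum.inr (i, a, r) => (Sum.inr (i, if a = 0 then r else rho i r), a)
  left_inv := by
    rintro ⟨x | ⟨i, r⟩, a⟩
    · rfl
    · by_cases h : a = 0
      · simp [h]
      · simp [h, rho_rho (i : ℕ) (by omega) r]
  right_inv := by
    rintro (a | ⟨i, a, r⟩)
    · rfl
    · by_cases h : a = 0
      · simp [h]
      · simp [h, rho_rho (i : ℕ) (by omega) r]

theorem phi_inl {n p : ℕ} (hp : p ≤ n) (u : Unit) (a : Fin 2) :
    phi hp (Sum.inl u, a) = Sum.inl a := rfl

theorem phi_inr {n p : ℕ} (hp : p ≤ n) (i : Fin p) (r : Fin n) (a : Fin 2) :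
    phi hp (Sum.inr (i, r), a) = Sum.inr (i, a, if a = 0 then r else rho i r) := rfl

/-- The `2 × 2` factor of `V`. -/
def E2 : Matrix (Fin 2) (Fin 2) (Polynomial ℤ) := !![1, q; q, 1]

/-- The nilpotent `2 × 2` factor. -/
def sig : Matrix (Fin 2) (Fin 2) (Polynomial ℤ) := !![0, 0; -q, 0]

open scoped Kronecker

theorem V_sub {n p : ℕ} (hn : 3 ≤ n) (hp : p = (n + 1) / 2) (hpn : p ≤ n) :
    (Vdih n p).submatrix (phi hpn) (phi hpn) = Wmat n p ⊗ₖ E2 := by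
  ext ⟨x, a⟩ ⟨y, b⟩ : 1
  rw [Matrix.submatrix_apply, Matrix.kroneckerMap_apply]
  rcases x with x | ⟨i, r⟩ <;> rcases y with y | ⟨j, c⟩
  · fin_cases a <;> fin_cases b <;> simp [phi_inl, Vdih, Wmat, E2]
  · fin_cases a <;> fin_cases b <;> simp [phi_inl, phi_inr, Vdih, Wmat, E2] <;> ring
  · fin_cases a <;> fin_cases b <;> simp [phi_inl, phi_inr, Vdih, Wmat, E2] <;> ring
  · have hi := i.2
    have hj := j.2
    simp only [phi_inr, Vdih, Wmat, Matrix.of_apply, Cmat_apply, Bmat_apply, wexp,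
      Nat.add_le_add_iff_right]
    rcases le_or_gt (i : ℕ) j with h | h
    · have hd := dm_rho (i : ℕ) j h (by omega) r c hn (by omega)
      simp only [h, if_true]
      fin_cases a <;> fin_cases b <;>
        simp [E2, hd, rho_rho (i : ℕ) (by omega) r, mul_comm]
    · have hd := dm_rho (j : ℕ) i h.le (by omega) c r hn (by omega)
      have h' : ¬ (i : ℕ) ≤ j := by omega
      simp only [h', if_false]
      fin_cases a <;> fin_cases b <;>
        simp [E2, hd, rho_rho (j : ℕ) (by omega) c, mul_comm]

/-- Indicator of block `0`. -/
def Eb (n p : ℕ) : Matrix (WIdx n p) (WIdx n p) (Polynomial ℤ) :=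
  Matrix.diagonal fun x => if blk x = 0 then 1 else 0

theorem T_sub {n p : ℕ} (hpn : p ≤ n) :
    (Tdih n p).submatrix (phi hpn) (phi hpn) = 1 + (1 - Eb n p) ⊗ₖ sig := by
  ext ⟨x, a⟩ ⟨y, b⟩ : 1
  rw [Matrix.submatrix_apply, Matrix.add_apply, Matrix.kroneckerMap_apply, Matrix.one_apply,
    Matrix.sub_apply, Matrix.one_apply, Eb, Matrix.diagonal_apply]
  rcases x with x | ⟨i, r⟩ <;> rcases y with y | ⟨j, c⟩
  · fin_cases a <;> fin_cases b <;> simp [phi_inl, Tdih, sig, blk]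
  · fin_cases a <;> fin_cases b <;> simp [phi_inl, phi_inr, Tdih, sig]
  · fin_cases a <;> fin_cases b <;> simp [phi_inl, phi_inr, Tdih, sig]
  · have hi := i.2
    simp only [phi_inr, Tdih, Matrix.of_apply, JK_apply]
    by_cases h : i = j
    · subst h
      have hinj : (rho (i : ℕ) r = rho i c) ↔ r = c := by
        refine ⟨fun h => ?_, fun h => by rw [h]⟩
        rw [← rho_rho (i : ℕ) (by omega) r, h, rho_rho (i : ℕ) (by omega)]
      fin_cases a <;> fin_cases b <;>
        by_cases hrc : r = c <;>
        simp [sig, hinj, rho_rho (i : ℕ) (by omega) r, rho_rho (i : ℕ) (by omega) c, blk, hrc] <;>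
        exact fun h => absurd h.symm hrc
    · fin_cases a <;> fin_cases b <;> simp [h]

/-- Predecessor in the full index type. -/
def prdD {n p : ℕ} (i : Fin p) (a : Fin 2) (r : Fin n) : DIdx n p :=
  if (i : ℕ) = 0 then Sum.inl a else Sum.inr (⟨(i : ℕ) - 1, by omega⟩, a, r)

theorem P_row {n p : ℕ} (i : Fin p) (a : Fin 2) (r : Fin n) (y : DIdx n p) :
    Pdih n p (Sum.inr (i, a, r)) y =
      (if y = Sum.inr (i, a, r) then 1 else 0) - (if y = prdD i a r then q else 0) := by
  rcases y with b | ⟨j, b, c⟩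
  · by_cases h : (i : ℕ) = 0 <;> by_cases h' : a = b <;> simp [Pdih, prdD, h, h', eq_comm]
  · simp only [Pdih, Matrix.of_apply]
    by_cases h : (i : ℕ) = 0
    · have : ¬ (i : ℕ) = j + 1 := by omega
      simp only [prdD, h, if_true]
      grind
    · simp only [prdD, h, if_false, Sum.inr.injEq, Prod.mk.injEq, Fin.ext_iff]
      grind

theorem S_row {n p : ℕ} (i : Fin p) (a : Fin 2) (r : Fin n) (y : DIdx n p) :
    Sdih n p (Sum.inr (i, a, r)) y =
      (if y = Sum.inr (i, a, r) then 1 else 0) -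
        (if (i : ℕ) = 0 then 0 else if y = prdD i a (rsucc r) then q else 0) := by
  rcases y with b | ⟨j, b, c⟩
  · by_cases h : (i : ℕ) = 0 <;> simp [Sdih, prdD, h]
  · simp only [Sdih, Matrix.of_apply, Jmat_apply]
    by_cases h : (i : ℕ) = 0
    · have : ¬ (i : ℕ) = j + 1 := by omega
      simp only [h, if_true]
      grind
    · simp only [prdD, h, if_false, Sum.inr.injEq, Prod.mk.injEq]
      have e : (j = ⟨(i : ℕ) - 1, by omega⟩) ↔ (i : ℕ) = j + 1 := by
        rw [Fin.ext_iff]; simp only; omega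
      simp only [e]
      by_cases h1 : i = j
      · subst h1
        grind
      · by_cases h2 : (i : ℕ) = j + 1 <;> by_cases h3 : c = rsucc r <;> by_cases h4 : a = b <;>
          grind

theorem S_mul_inr {n p : ℕ} (X : Matrix (DIdx n p) (DIdx n p) (Polynomial ℤ))
    (i : Fin p) (a : Fin 2) (r : Fin n) (y : DIdx n p) :
    (Sdih n p * X) (Sum.inr (i, a, r)) y = X (Sum.inr (i, a, r)) y -
      if (i : ℕ) = 0 then 0 else q * X (prdD i a (rsucc r)) y := by
  by_cases h : (i : ℕ) = 0 <;>
  simp only [Matrix.mul_apply, S_row, sub_mul, Finset.sum_sub_distrib, ite_mul, one_mul,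
    zero_mul, Finset.sum_ite_eq', Finset.mem_univ, if_true, h, if_false, Finset.sum_const_zero]

theorem S_mul_inl {n p : ℕ} (X : Matrix (DIdx n p) (DIdx n p) (Polynomial ℤ))
    (a : Fin 2) (y : DIdx n p) :
    (Sdih n p * X) (Sum.inl a) y = X (Sum.inl a) y := by
  rw [Matrix.mul_apply, Fintype.sum_sum_type]
  simp [Sdih]

theorem prdD_zero {n p : ℕ} (hpn : p ≤ n) (i : Fin p) (a : Fin 2) (r s : Fin n)
    (h : (i : ℕ) = 0) : prdD i a r = phi hpn (prdP i s, a) := by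
  simp [prdD, prdP, h, phi_inl]

theorem prdD_lo {n p : ℕ} (hpn : p ≤ n) (i : Fin p) (r : Fin n) :
    prdD i 0 r = phi hpn (prdP i r, 0) := by
  unfold prdD prdP
  split_ifs
  · rfl
  · rfl

theorem prdD_hi {n p : ℕ} (hpn : p ≤ n) (i : Fin p) (r : Fin n) :
    prdD i 1 (rho i r) = phi hpn (prdP i (rsucc r), 1) := by
  by_cases h : (i : ℕ) = 0
  · exact prdD_zero hpn i 1 _ _ h
  · have := rho_rsucc ((i : ℕ) - 1) (by omega) r
    have e : (i : ℕ) - 1 + 1 = i := by omega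
    rw [e] at this
    simp [prdD, prdP, h, phi_inr, this]

theorem prdD_hi' {n p : ℕ} (hpn : p ≤ n) (i : Fin p) (r : Fin n) :
    prdD i 1 (rsucc (rho i r)) = phi hpn (prdP i r, 1) := by
  by_cases h : (i : ℕ) = 0
  · exact prdD_zero hpn i 1 _ _ h
  · have := rsucc_rho ((i : ℕ) - 1) (by omega) r
    have e : (i : ℕ) - 1 + 1 = i := by omega
    rw [e] at this
    simp [prdD, prdP, h, phi_inr, this]

theorem SP_sub {n p : ℕ} (hpn : p ≤ n) :
    (Sdih n p * Pdih n p).submatrix (phi hpn) (phi hpn) =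
      N2 n p ⊗ₖ (1 : Matrix (Fin 2) (Fin 2) (Polynomial ℤ)) + Eb n p ⊗ₖ sig := by
  ext ⟨x, a⟩ ⟨y, b⟩ : 1
  rw [Matrix.submatrix_apply, Matrix.add_apply, Matrix.kroneckerMap_apply,
    Matrix.kroneckerMap_apply, Eb, Matrix.diagonal_apply]
  rcases x with x | ⟨i, r⟩
  · rw [phi_inl, S_mul_inl, N2, S2_mul_inl]
    rcases y with y | ⟨j, c⟩
    · fin_cases a <;> fin_cases b <;> simp [phi_inl, Pdih, P2, sig, blk]
    · fin_cases a <;> fin_cases b <;> simp [phi_inr, Pdih, P2, sig]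
  · have hb : (blk (Sum.inr (i, r) : WIdx n p) = 0) = False := by simp [blk]
    simp only [hb, if_false, ite_self, zero_mul, add_zero]
    rw [N2, S2_mul_inr, P2_row, phi_inr, S_mul_inr,
      P_row, ← phi_inr hpn]
    by_cases h0 : (i : ℕ) = 0
    · rw [if_pos h0, if_pos h0, prdD_zero hpn i a _ r h0]
      simp only [(phi hpn).injective.eq_iff, Prod.mk.injEq, Matrix.one_apply]
      by_cases hab : a = b
      · simp [hab]
      · simp [hab, Ne.symm hab]
    · rw [if_neg h0, if_neg h0]
      have eD : ∀ s, prdD (n := n) i a s = Sum.inr (⟨(i : ℕ) - 1, by omega⟩, a, s) := by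
        intro s; simp [prdD, h0]
      have eP : ∀ s, prdP (n := n) i s = Sum.inr (⟨(i : ℕ) - 1, by omega⟩, s) := by
        intro s; simp [prdP, h0]
      rw [eD (rsucc _), eP (rsucc _), P_row, P2_row, ← eD, ← eP]
      have ha : a = 0 ∨ a = 1 := by omega
      rcases ha with rfl | rfl
      · simp only [if_true, prdD_lo hpn, (phi hpn).injective.eq_iff, Prod.mk.injEq,
          Matrix.one_apply]
        by_cases hab : (0 : Fin 2) = b
        · simp [← hab]
        · simp [hab, Ne.symm hab]
      · have h10 : ¬ (1 : Fin 2) = 0 := by decide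
        have h2 := rsucc_rho ((i : ℕ) - 1) (by omega) r
        have e : (i : ℕ) - 1 + 1 = i := by omega
        rw [e] at h2
        have h3 := prdD_hi hpn ⟨(i : ℕ) - 1, by omega⟩ r
        simp only [← h2] at h3
        simp only [if_neg h10, h3, prdD_hi hpn, prdD_hi' hpn, (phi hpn).injective.eq_iff,
          Prod.mk.injEq, Matrix.one_apply]
        by_cases hab : (1 : Fin 2) = b
        · have hq : ∀ (Q : Prop) [Decidable Q],
              (if Q then q else 0) = q * (if Q then 1 else 0) := by
            intro Q _; split_ifs <;> simp
          simp only [← hab, and_true, if_true, mul_one, hq]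
          ring
        · simp [hab, Ne.symm hab]

theorem Eb_mul_N2 (n p : ℕ) : Eb n p * N2 n p = Eb n p := by
  ext x y : 1
  rw [Eb, Matrix.diagonal_mul, Matrix.diagonal_apply]
  by_cases h : blk x = 0
  · rw [N2_apply x y (by omega)]
    simp [h]
  · simp [h]

theorem Eb_mul_Eb (n p : ℕ) : Eb n p * Eb n p = Eb n p := by
  rw [Eb, Matrix.diagonal_mul_diagonal]
  congr 1
  ext x
  by_cases h : blk x = 0 <;> simp [h]

theorem TSP_sub {n p : ℕ} (hpn : p ≤ n) :
    (Tdih n p * Sdih n p * Pdih n p).submatrix (phi hpn) (phi hpn) =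
      N2 n p ⊗ₖ (1 + sig) := by
  rw [Matrix.mul_assoc, ← Matrix.submatrix_mul_equiv _ _ _ (phi hpn) _, T_sub, SP_sub,
    Matrix.add_mul, Matrix.one_mul, Matrix.mul_add, ← Matrix.mul_kronecker_mul,
    ← Matrix.mul_kronecker_mul, Matrix.sub_mul, Matrix.sub_mul, Eb_mul_N2, Eb_mul_Eb,
    Matrix.one_mul, Matrix.one_mul, sub_self, Matrix.zero_kronecker, add_zero, Matrix.mul_one,
    Matrix.kronecker_add, add_assoc, ← Matrix.add_kronecker, add_sub_cancel]

theorem D_sub {n p : ℕ} (hpn : p ≤ n) :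
    (Ddih n p).submatrix (phi hpn) (phi hpn) =
      Matrix.diagonal D2 ⊗ₖ Matrix.diagonal ![1, 1 - q ^ 2] := by
  ext ⟨x, a⟩ ⟨y, b⟩ : 1
  rw [Matrix.submatrix_apply, Matrix.kroneckerMap_apply, Matrix.diagonal_apply,
    Matrix.diagonal_apply]
  rcases x with x | ⟨i, r⟩ <;> rcases y with y | ⟨j, c⟩
  · fin_cases a <;> fin_cases b <;> simp [phi_inl, Ddih, blk, D2]
  · simp [phi_inl, phi_inr, Ddih]
  · simp [phi_inl, phi_inr, Ddih]
  · have hi := i.2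
    simp only [phi_inr, Ddih, Matrix.of_apply, D2, blk]
    by_cases h : i = j
    · subst h
      have hinj : (rho (i : ℕ) r = rho i c) ↔ r = c := by
        refine ⟨fun h => ?_, fun h => by rw [h]⟩
        rw [← rho_rho (i : ℕ) (by omega) r, h, rho_rho (i : ℕ) (by omega)]
      by_cases h0 : (i : ℕ) = 0 <;> by_cases h1 : r = c <;> fin_cases a <;> fin_cases b <;>
        simp [h1, hinj] <;> simp [h0] <;> ring
    · simp [h]

theorem sig_conj : (1 + sig) * E2 * (1 + sig)ᵀ = Matrix.diagonal ![1, 1 - q ^ 2] := by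
  ext i j : 1
  fin_cases i <;> fin_cases j <;>
    simp [sig, E2, Matrix.mul_apply, Fin.sum_univ_two, Matrix.add_apply, Matrix.one_apply] <;> ring

theorem main_eq {n p : ℕ} (hn : 3 ≤ n) (hp : p = (n + 1) / 2) :
    (Tdih n p * Sdih n p * Pdih n p) * Vdih n p *
        (Tdih n p * Sdih n p * Pdih n p)ᵀ = Ddih n p := by
  have hpn : p ≤ n := by omega
  have h : ((Tdih n p * Sdih n p * Pdih n p) * Vdih n p *
        (Tdih n p * Sdih n p * Pdih n p)ᵀ).submatrix (phi hpn) (phi hpn) =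
      (Ddih n p).submatrix (phi hpn) (phi hpn) := by
    rw [← Matrix.submatrix_mul_equiv _ _ _ (phi hpn) _,
      ← Matrix.submatrix_mul_equiv _ _ _ (phi hpn) _, ← Matrix.transpose_submatrix, TSP_sub,
      V_sub hn hp, D_sub, ← Matrix.kroneckerMap_transpose, ← Matrix.mul_kronecker_mul,
      ← Matrix.mul_kronecker_mul, NWN hn hp, sig_conj]
  ext x y : 1
  have h2 := congrFun (congrFun h ((phi hpn).symm x)) ((phi hpn).symm y)
  simpa only [Matrix.submatrix_apply, Equiv.apply_symm_apply] using h2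

theorem main_det {n p : ℕ} (hp : p = (n + 1) / 2) :
    (Tdih n p * Sdih n p * Pdih n p).det = 1 := by
  have hpn : p ≤ n := by omega
  rw [← Matrix.det_submatrix_equiv_self (phi hpn), TSP_sub, Matrix.det_kronecker, N2_det]
  have : (1 + sig).det = 1 := by
    simp [Matrix.det_fin_two, sig]
  rw [this]; simp

/-- Sorting position. -/
def srt {n p : ℕ} : DIdx n p → ℕ
  | Sum.inl a => a
  | Sum.inr (i, a, r) =>
      if (i : ℕ) = 0 then (if a = 0 then 2 + r else n + 2 + r)
      else if a = 0 then n + 2 + ((i : ℕ) * n + r)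
      else n + 2 + n * p + (((i : ℕ) - 1) * n + r)

theorem mul_add_lt {n p i r : ℕ} (hi : i < p) (hr : r < n) : i * n + r < n * p := by
  have : (i + 1) * n ≤ p * n := Nat.mul_le_mul_right n hi
  rw [mul_comm n p]
  linarith [add_mul i 1 n]

theorem srt_lt {n p : ℕ} (x : DIdx n p) : srt x < 2 + 2 * n * p := by
  rcases x with a | ⟨i, a, r⟩
  · have := a.2
    simp only [srt]; omega
  · have hr := r.2
    have hi := i.2
    have h1 := mul_add_lt hi hr
    have h2 : 2 * n * p = n * p + n * p := by ring
    have h3 : n * 1 ≤ n * p := Nat.mul_le_mul_left n (by have := i.2; omega)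
    simp only [srt]
    split_ifs with h4 h5 h5
    · omega
    · omega
    · have : (1 + 1) * n ≤ p * n := Nat.mul_le_mul_right n (by omega)
      rw [mul_comm p n] at this
      omega
    · have : ((i : ℕ) - 1) * n + n = i * n := by
        obtain ⟨k, hk⟩ : ∃ k, (i : ℕ) = k + 1 := ⟨(i : ℕ) - 1, by omega⟩
        rw [hk]; simp [add_mul]
      omega

theorem div_inj {n i j r c : ℕ} (hr : r < n) (hc : c < n) (h : i * n + r = j * n + c) :
    i = j ∧ r = c := by
  have h1 : (i * n + r) / n = i := by
    rw [mul_comm, Nat.mul_add_div (by omega), Nat.div_eq_of_lt hr, add_zero]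
  have h2 : (j * n + c) / n = j := by
    rw [mul_comm, Nat.mul_add_div (by omega), Nat.div_eq_of_lt hc, add_zero]
  have h3 : i = j := by rw [← h1, ← h2, h]
  subst h3
  exact ⟨rfl, by omega⟩

theorem srt_inj {n p : ℕ} : Function.Injective (srt : DIdx n p → ℕ) := by
  have aux : ∀ (i : Fin p) (r : Fin n), (i : ℕ) ≠ 0 → n ≤ (i : ℕ) * n + r := by
    intro i r h
    have : 1 * n ≤ (i : ℕ) * n := Nat.mul_le_mul_right n (by omega)
    omega
  rintro (a | ⟨i, a, r⟩) (b | ⟨j, b, c⟩) h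
  · simp only [srt] at h
    rw [Fin.ext h]
  · have := a.2
    simp only [srt] at h
    exfalso
    split_ifs at h <;> omega
  · have := b.2
    simp only [srt] at h
    exfalso
    split_ifs at h <;> omega
  · have hr := r.2
    have hc := c.2
    have h1 := mul_add_lt i.2 hr
    have h2 := mul_add_lt j.2 hc
    have h3 : n * 1 ≤ n * p := Nat.mul_le_mul_left n (by have := i.2; omega)
    have a1 := aux i r
    have a2 := aux j c
    have key : (i : ℕ) = j ∧ a = b ∧ (r : ℕ) = c := by
      simp only [srt] at h
      split_ifs at h with g1 g2 g3 g4 g3 g4 g2 g3 g4 g3 g4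
      all_goals first
        | (exfalso; omega)
        | (refine ⟨?_, ?_, ?_⟩ <;> omega)
        | (have hh := div_inj hr hc (by omega : (i : ℕ) * n + r = (j : ℕ) * n + c)
           refine ⟨?_, ?_, ?_⟩ <;> omega)
        | (have hh := div_inj hr hc (by omega : ((i : ℕ) - 1) * n + r = ((j : ℕ) - 1) * n + c)
           refine ⟨?_, ?_, ?_⟩ <;> omega)
    obtain ⟨k1, k2, k3⟩ := key
    rw [Fin.ext k1, k2, Fin.ext k3]

/-- Sorting equivalence. -/
def srtE (n p : ℕ) : DIdx n p ≃ Fin (2 + 2 * n * p) :=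
  Equiv.ofBijective (fun x => ⟨srt x, srt_lt x⟩) (by
    rw [Fintype.bijective_iff_injective_and_card]
    constructor
    · intro x y h
      exact srt_inj (by simpa using h)
    · simp; ring)

theorem Ddih_snf {n p : ℕ} (x y : DIdx n p) :
    Ddih n p x y = if x = y then snfDih n p (srt x) else 0 := by
  rcases x with a | ⟨i, a, r⟩ <;> rcases y with b | ⟨j, b, c⟩
  · fin_cases a <;> fin_cases b <;> simp [Ddih, snfDih, srt]
  · simp [Ddih]
  · simp [Ddih]
  · have hr := r.2
    have h1 := mul_add_lt i.2 hr
    have h3 : n * 1 ≤ n * p := Nat.mul_le_mul_left n (by have := i.2; omega)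
    by_cases h : i = j ∧ a = b ∧ r = c
    · obtain ⟨rfl, rfl, rfl⟩ := h
      have h4 : (i : ℕ) ≠ 0 → n ≤ (i : ℕ) * n + r := by
        intro h
        have : 1 * n ≤ (i : ℕ) * n := Nat.mul_le_mul_right n (by omega)
        omega
      simp only [Ddih, Matrix.of_apply, and_self, if_true, snfDih, srt]
      split_ifs <;> first | rfl | (exfalso; omega)
    · have h' : ¬ ((Sum.inr (i, a, r) : DIdx n p) = Sum.inr (j, b, c)) := by simpa using h
      rw [if_neg h']
      simp only [Ddih, Matrix.of_apply, if_neg h]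


/-- **Theorem 3.5.**  For every `n ≥ 3`, with `V` the `q`-Varchenko matrix of the
dihedral model `D_n`: `(TSP) V (TSP)ᵀ` is the explicit diagonal matrix `Ddih`,
`det (TSP) = ±1`, and consequently `V` has Smith normal form
`diag(1, t·I_{n+1}, t²·I_{np}, t³·I_{n(p-1)})` over `ℤ[q]`, realized by a congruence
over `ℤ[q]` (after a further permutation congruence sorting the diagonal entries). -/
theorem dihedral_snf (n p : ℕ) (hn : 3 ≤ n) (hp : p = (n + 1) / 2) :
    (Tdih n p * Sdih n p * Pdih n p) * Vdih n p *
        (Tdih n p * Sdih n p * Pdih n p)ᵀ = Ddih n p ∧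
      ((Tdih n p * Sdih n p * Pdih n p).det = 1 ∨
        (Tdih n p * Sdih n p * Pdih n p).det = -1) ∧
      ∃ (M : Matrix (DIdx n p) (DIdx n p) (Polynomial ℤ))
        (e : DIdx n p ≃ Fin (2 + 2 * n * p)),
        (M.det = 1 ∨ M.det = -1) ∧
          ∀ x y, (M * Vdih n p * Mᵀ) x y =
            if x = y then snfDih n p ((e x : Fin (2 + 2 * n * p)) : ℕ) else 0 := by
  refine ⟨main_eq hn hp, Or.inl (main_det hp), Tdih n p * Sdih n p * Pdih n p, srtE n p,
    Or.inl (main_det hp), fun x y => ?_⟩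
  rw [main_eq hn hp, Ddih_snf]
  rfl
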